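/- For every LTL_horn^□○ ontology O and every data instance A consistent with O, there exist positive integers s_{O,A} ≤ 2^{|O|} and p_{O,A} ≤ 2^{2|O|} such that τ_{O,A}(n) = τ_{O,A}(n − p_{O,A}) for all n ≤ min A − s_{O,A}, and τ_{O,A}(n) = τ_{O,A}(n + p_{O,A}) for all n ≥ max A + s_{O,A}. -/

import Mathlib

namespace LTLOMQ

/-! ## Temporal concepts (LTL formulas) and their semantics over (ℤ,<) -/

/-- Temporal concepts: arbitrary LTL formulas over atomic concepts indexed by `ℕ`. -/
inductive TC : Type where
  | top : TC
  | atom : ℕ → TC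
  | neg : TC → TC
  | and : TC → TC → TC
  | or : TC → TC → TC
  | nextF : TC → TC
  | diamF : TC → TC
  | boxF : TC → TC
  | untl : TC → TC → TC
  | nextP : TC → TC
  | diamP : TC → TC
  | boxP : TC → TC
  | since : TC → TC → TC

/-- A temporal interpretation assigns to each atomic concept a subset of ℤ. -/
abbrev Itp : Type := ℕ → Set ℤ

/-- The extension of a temporal concept in an interpretation
(strict semantics over `(ℤ,<)`). -/
def TC.sem (M : Itp) : TC → Set ℤ
  | .top => Set.univ
  | .atom a => M a
  | .neg C => (TC.sem M C)ᶜ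
  | .and C D => TC.sem M C ∩ TC.sem M D
  | .or C D => TC.sem M C ∪ TC.sem M D
  | .nextF C => {n | n + 1 ∈ TC.sem M C}
  | .diamF C => {n | ∃ k, n < k ∧ k ∈ TC.sem M C}
  | .boxF C => {n | ∀ k, n < k → k ∈ TC.sem M C}
  | .untl C D => {n | ∃ k, n < k ∧ k ∈ TC.sem M D ∧ ∀ m, n < m → m < k → m ∈ TC.sem M C}
  | .nextP C => {n | n - 1 ∈ TC.sem M C}
  | .diamP C => {n | ∃ k, k < n ∧ k ∈ TC.sem M C}
  | .boxP C => {n | ∀ k, k < n → k ∈ TC.sem M C}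
  | .since C D => {n | ∃ k, k < n ∧ k ∈ TC.sem M D ∧ ∀ m, k < m → m < n → m ∈ TC.sem M C}

/-- Basic temporal concepts: built from atomic concepts using ○F, ○P, □F, □P. -/
inductive TC.IsBasic : TC → Prop
  | atom (a : ℕ) : TC.IsBasic (.atom a)
  | nextF {C : TC} : TC.IsBasic C → TC.IsBasic (.nextF C)
  | nextP {C : TC} : TC.IsBasic C → TC.IsBasic (.nextP C)
  | boxF {C : TC} : TC.IsBasic C → TC.IsBasic (.boxF C)
  | boxP {C : TC} : TC.IsBasic C → TC.IsBasic (.boxP C)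

/-- Basic temporal concepts using □F and □P only. -/
inductive TC.IsBasicBox : TC → Prop
  | atom (a : ℕ) : TC.IsBasicBox (.atom a)
  | boxF {C : TC} : TC.IsBasicBox C → TC.IsBasicBox (.boxF C)
  | boxP {C : TC} : TC.IsBasicBox C → TC.IsBasicBox (.boxP C)

/-- Basic temporal concepts using ○F and ○P only. -/
inductive TC.IsBasicNext : TC → Prop
  | atom (a : ℕ) : TC.IsBasicNext (.atom a)
  | nextF {C : TC} : TC.IsBasicNext C → TC.IsBasicNext (.nextF C)
  | nextP {C : TC} : TC.IsBasicNext C → TC.IsBasicNext (.nextP C)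

/-- Positive temporal concepts: no occurrences of ¬. -/
inductive TC.IsPositive : TC → Prop
  | top : TC.IsPositive .top
  | atom (a : ℕ) : TC.IsPositive (.atom a)
  | and {C D : TC} : TC.IsPositive C → TC.IsPositive D → TC.IsPositive (.and C D)
  | or {C D : TC} : TC.IsPositive C → TC.IsPositive D → TC.IsPositive (.or C D)
  | nextF {C : TC} : TC.IsPositive C → TC.IsPositive (.nextF C)
  | diamF {C : TC} : TC.IsPositive C → TC.IsPositive (.diamF C)
  | boxF {C : TC} : TC.IsPositive C → TC.IsPositive (.boxF C)
  | untl {C D : TC} : TC.IsPositive C → TC.IsPositive D → TC.IsPositive (.untl C D)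
  | nextP {C : TC} : TC.IsPositive C → TC.IsPositive (.nextP C)
  | diamP {C : TC} : TC.IsPositive C → TC.IsPositive (.diamP C)
  | boxP {C : TC} : TC.IsPositive C → TC.IsPositive (.boxP C)
  | since {C D : TC} : TC.IsPositive C → TC.IsPositive D → TC.IsPositive (.since C D)

/-- Prior-LTL formulas: Boolean connectives and □P, ◇P, □F, ◇F only. -/
inductive TC.IsPrior : TC → Prop
  | atom (a : ℕ) : TC.IsPrior (.atom a)
  | neg {C : TC} : TC.IsPrior C → TC.IsPrior (.neg C)
  | and {C D : TC} : TC.IsPrior C → TC.IsPrior D → TC.IsPrior (.and C D)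
  | or {C D : TC} : TC.IsPrior C → TC.IsPrior D → TC.IsPrior (.or C D)
  | boxF {C : TC} : TC.IsPrior C → TC.IsPrior (.boxF C)
  | boxP {C : TC} : TC.IsPrior C → TC.IsPrior (.boxP C)
  | diamF {C : TC} : TC.IsPrior C → TC.IsPrior (.diamF C)
  | diamP {C : TC} : TC.IsPrior C → TC.IsPrior (.diamP C)

/-- Number of occurrences of temporal operators in a temporal concept. -/
def TC.tempOps : TC → ℕ
  | .top => 0
  | .atom _ => 0
  | .neg C => TC.tempOps C
  | .and C D => TC.tempOps C + TC.tempOps D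
  | .or C D => TC.tempOps C + TC.tempOps D
  | .nextF C => TC.tempOps C + 1
  | .diamF C => TC.tempOps C + 1
  | .boxF C => TC.tempOps C + 1
  | .untl C D => TC.tempOps C + TC.tempOps D + 1
  | .nextP C => TC.tempOps C + 1
  | .diamP C => TC.tempOps C + 1
  | .boxP C => TC.tempOps C + 1
  | .since C D => TC.tempOps C + TC.tempOps D + 1

/-- Number of occurrences of symbols in a temporal concept. -/
def TC.size : TC → ℕ
  | .top => 1
  | .atom _ => 1
  | .neg C => TC.size C + 1
  | .and C D => TC.size C + TC.size D + 1
  | .or C D => TC.size C + TC.size D + 1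
  | .nextF C => TC.size C + 1
  | .diamF C => TC.size C + 1
  | .boxF C => TC.size C + 1
  | .untl C D => TC.size C + TC.size D + 1
  | .nextP C => TC.size C + 1
  | .diamP C => TC.size C + 1
  | .boxP C => TC.size C + 1
  | .since C D => TC.size C + TC.size D + 1

/-- The set of subconcepts of a temporal concept. -/
def TC.subs : TC → Set TC
  | .top => {.top}
  | .atom a => {.atom a}
  | .neg C => insert (.neg C) (TC.subs C)
  | .and C D => insert (.and C D) (TC.subs C ∪ TC.subs D)
  | .or C D => insert (.or C D) (TC.subs C ∪ TC.subs D)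
  | .nextF C => insert (.nextF C) (TC.subs C)
  | .diamF C => insert (.diamF C) (TC.subs C)
  | .boxF C => insert (.boxF C) (TC.subs C)
  | .untl C D => insert (.untl C D) (TC.subs C ∪ TC.subs D)
  | .nextP C => insert (.nextP C) (TC.subs C)
  | .diamP C => insert (.diamP C) (TC.subs C)
  | .boxP C => insert (.boxP C) (TC.subs C)
  | .since C D => insert (.since C D) (TC.subs C ∪ TC.subs D)

/-- The set of atomic concepts occurring in a temporal concept. -/
def TC.atoms : TC → Set ℕ
  | .top => ∅
  | .atom a => {a}
  | .neg C => TC.atoms C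
  | .and C D => TC.atoms C ∪ TC.atoms D
  | .or C D => TC.atoms C ∪ TC.atoms D
  | .nextF C => TC.atoms C
  | .diamF C => TC.atoms C
  | .boxF C => TC.atoms C
  | .untl C D => TC.atoms C ∪ TC.atoms D
  | .nextP C => TC.atoms C
  | .diamP C => TC.atoms C
  | .boxP C => TC.atoms C
  | .since C D => TC.atoms C ∪ TC.atoms D

/-! ## Clauses, ontologies, data instances -/

/-- A clause `C₁ ∧ … ∧ C_k → C_{k+1} ∨ … ∨ C_{k+m}`. -/
structure Clause : Type where
  prem : List TC
  concl : List TC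

/-- A clause is true in `M` if the intersection of the extensions of the premises
is contained in the union of the extensions of the conclusions. -/
def Clause.holds (M : Itp) (cl : Clause) : Prop :=
  ∀ n : ℤ, (∀ C ∈ cl.prem, n ∈ TC.sem M C) → ∃ C ∈ cl.concl, n ∈ TC.sem M C

/-- An ontology is a finite set (list) of clauses. -/
abbrev Ontology : Type := List Clause

def Clause.AllBasic (cl : Clause) : Prop :=
  (∀ C ∈ cl.prem, C.IsBasic) ∧ (∀ C ∈ cl.concl, C.IsBasic)

def Clause.AllBasicBox (cl : Clause) : Prop :=
  (∀ C ∈ cl.prem, C.IsBasicBox) ∧ (∀ C ∈ cl.concl, C.IsBasicBox)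

def Clause.AllBasicNext (cl : Clause) : Prop :=
  (∀ C ∈ cl.prem, C.IsBasicNext) ∧ (∀ C ∈ cl.concl, C.IsBasicNext)

/-- Horn: at most one disjunct in the conclusion. -/
def Clause.Horn (cl : Clause) : Prop := cl.concl.length ≤ 1

/-- Krom (binary): at most two concepts altogether. -/
def Clause.Krom (cl : Clause) : Prop := cl.prem.length + cl.concl.length ≤ 2

/-- LTL_bool^□○ ontologies. -/
def Ontology.BoolBoxNext (O : Ontology) : Prop := ∀ cl ∈ O, cl.AllBasic
/-- LTL_bool^□ ontologies. -/
def Ontology.BoolBox (O : Ontology) : Prop := ∀ cl ∈ O, cl.AllBasicBox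
/-- LTL_krom^○ ontologies. -/
def Ontology.KromNext (O : Ontology) : Prop := ∀ cl ∈ O, cl.AllBasicNext ∧ cl.Krom
/-- LTL_krom^□○ ontologies. -/
def Ontology.KromBoxNext (O : Ontology) : Prop := ∀ cl ∈ O, cl.AllBasic ∧ cl.Krom
/-- LTL_horn^□○ ontologies. -/
def Ontology.HornBoxNext (O : Ontology) : Prop := ∀ cl ∈ O, cl.AllBasic ∧ cl.Horn
/-- LTL_horn^□ ontologies. -/
def Ontology.HornBox (O : Ontology) : Prop := ∀ cl ∈ O, cl.AllBasicBox ∧ cl.Horn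
/-- LTL_core^□○ ontologies. -/
def Ontology.CoreBoxNext (O : Ontology) : Prop := ∀ cl ∈ O, cl.AllBasic ∧ cl.Horn ∧ cl.Krom

/-- Number of occurrences of symbols in a clause. -/
def Clause.size (cl : Clause) : ℕ :=
  (cl.prem.map TC.size).sum + (cl.concl.map TC.size).sum + 1

/-- Number of occurrences of symbols in an ontology. -/
def Ontology.size (O : Ontology) : ℕ := (O.map Clause.size).sum

/-- The atomic concept `a` occurs in the ontology `O`. -/
def Ontology.occurs (O : Ontology) (a : ℕ) : Prop :=
  ∃ cl ∈ O, (∃ C ∈ cl.prem, a ∈ C.atoms) ∨ (∃ C ∈ cl.concl, a ∈ C.atoms)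

/-- The set of subconcepts of (concepts occurring in) an ontology. -/
def Ontology.subs (O : Ontology) : Set TC :=
  {C | ∃ cl ∈ O, ∃ D : TC, (D ∈ cl.prem ∨ D ∈ cl.concl) ∧ C ∈ D.subs}

/-- A flat concept: an atomic concept, or a single ○F or ○P applied to an atomic concept. -/
def TC.IsFlat : TC → Prop
  | .atom _ => True
  | .nextF (.atom _) => True
  | .nextP (.atom _) => True
  | _ => False

/-- An ontology without nested temporal operators. -/
def Ontology.Flat (O : Ontology) : Prop :=
  ∀ cl ∈ O, (∀ C ∈ cl.prem, C.IsFlat) ∧ (∀ C ∈ cl.concl, C.IsFlat)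

/-- A data instance: a finite nonempty set of timestamped atoms, normalized so that
the minimal timestamp is 0 and the maximal one is ≥ 1. -/
structure DataInstance : Type where
  atoms : Finset (ℕ × ℤ)
  nonneg : ∀ p ∈ atoms, 0 ≤ p.2
  has_zero : ∃ p ∈ atoms, p.2 = 0
  has_one : ∃ p ∈ atoms, 1 ≤ p.2

theorem DataInstance.ts_nonempty (A : DataInstance) :
    (A.atoms.image Prod.snd).Nonempty := by
  obtain ⟨p, hp, -⟩ := A.has_zero
  exact ⟨p.2, Finset.mem_image_of_mem _ hp⟩

/-- min A: the minimal timestamp occurring in the data instance (equal to 0). -/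
def DataInstance.minT (A : DataInstance) : ℤ :=
  (A.atoms.image Prod.snd).min' A.ts_nonempty

/-- max A: the maximal timestamp occurring in the data instance. -/
def DataInstance.maxT (A : DataInstance) : ℤ :=
  (A.atoms.image Prod.snd).max' A.ts_nonempty

/-- The active temporal domain tem(A). -/
def DataInstance.tem (A : DataInstance) : Set ℤ := Set.Icc A.minT A.maxT

/-- The interpretation of atomic concepts in the first-order structure S_A. -/
def DataInstance.itp (A : DataInstance) : Itp := fun a => {n | (a, n) ∈ A.atoms}

/-- `M` is a model of the knowledge base `(O, A)`. -/
def IsModel (M : Itp) (O : Ontology) (A : DataInstance) : Prop :=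
  (∀ cl ∈ O, cl.holds M) ∧ ∀ p ∈ A.atoms, p.2 ∈ M p.1

/-- The ontology `O` is consistent. -/
def Ontology.Consistent (O : Ontology) : Prop := ∃ M : Itp, ∀ cl ∈ O, cl.holds M

/-- The data instance `A` is consistent with `O`. -/
def ConsistentWith (O : Ontology) (A : DataInstance) : Prop := ∃ M : Itp, IsModel M O A

/-- Certain answers to the OMIQ `(O, κ)` over `A` (within the active domain). -/
def certAns (O : Ontology) (κ : TC) (A : DataInstance) : Set ℤ :=
  {ℓ | ℓ ∈ A.tem ∧ ∀ M : Itp, IsModel M O A → ℓ ∈ TC.sem M κ}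

/-- Certain answers to the OMIQ `(O, κ)` over `A` and ℤ. -/
def certAnsZ (O : Ontology) (κ : TC) (A : DataInstance) : Set ℤ :=
  {ℓ | ∀ M : Itp, IsModel M O A → ℓ ∈ TC.sem M κ}

/-! ## First-order, MSO and FO(RPR) formulas over the temporal structures -/

/-- Formulas of the target languages: first-order variables are indexed by `ℕ`,
as are second-order (set) variables and the recursively defined relation variables
of FO(RPR).  The constructors `qprev j` and `qapp j x` stand for `Q_j(t-1)` (inside
a recursive definition block) and `Q_j(x)`, respectively; `rpr n Θ tv ψ` is the
relational-primitive-recursion construct `[Q₁(t) ≡ Θ₁; …; Q_n(t) ≡ Θ_n] ψ`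
with recursion variable `tv`. -/
inductive Fml : Type where
  | falsum : Fml
  | atom : ℕ → ℕ → Fml        -- A(x)
  | lt : ℕ → ℕ → Fml          -- x < y
  | eq : ℕ → ℕ → Fml          -- x = y
  | succ : ℕ → ℕ → Fml        -- x = y + 1
  | mod : ℕ → ℕ → Fml         -- x ≡ 0 (mod n)
  | svar : ℕ → ℕ → Fml        -- X(x), X a set variable
  | qprev : ℕ → Fml           -- Q_j(t−1)
  | qapp : ℕ → ℕ → Fml        -- Q_j(x)
  | neg : Fml → Fml
  | and : Fml → Fml → Fml
  | or : Fml → Fml → Fml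
  | ex : ℕ → Fml → Fml
  | all : ℕ → Fml → Fml
  | exS : ℕ → Fml → Fml       -- second-order ∃
  | allS : ℕ → Fml → Fml      -- second-order ∀
  | rpr : (n : ℕ) → (Fin n → Fml) → ℕ → Fml → Fml

/-- Evaluation of a formula over the structure with (active) domain `D ⊆ ℤ`
and interpretation `I` of the unary predicates; `env` assigns first-order
variables, `senv` set variables, `prev` the placeholders `Q_j(t-1)` and
`Q` the defined relation variables. First-order quantifiers range over `D`,
second-order quantifiers over subsets of `D`. -/
def Fml.eval (D : Set ℤ) (I : ℕ → Set ℤ) :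
    Fml → (ℕ → ℤ) → (ℕ → Set ℤ) → (ℕ → Prop) → (ℕ → ℤ → Prop) → Prop
  | .falsum, _, _, _, _ => False
  | .atom a x, env, _, _, _ => env x ∈ I a
  | .lt x y, env, _, _, _ => env x < env y
  | .eq x y, env, _, _, _ => env x = env y
  | .succ x y, env, _, _, _ => env x = env y + 1
  | .mod n x, env, _, _, _ => (n : ℤ) ∣ env x
  | .svar X x, env, senv, _, _ => env x ∈ senv X
  | .qprev j, _, _, prev, _ => prev j
  | .qapp j x, env, _, _, Q => Q j (env x)
  | .neg φ, env, senv, prev, Q => ¬ Fml.eval D I φ env senv prev Q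
  | .and φ ψ, env, senv, prev, Q =>
      Fml.eval D I φ env senv prev Q ∧ Fml.eval D I ψ env senv prev Q
  | .or φ ψ, env, senv, prev, Q =>
      Fml.eval D I φ env senv prev Q ∨ Fml.eval D I ψ env senv prev Q
  | .ex x φ, env, senv, prev, Q =>
      ∃ d ∈ D, Fml.eval D I φ (Function.update env x d) senv prev Q
  | .all x φ, env, senv, prev, Q =>
      ∀ d ∈ D, Fml.eval D I φ (Function.update env x d) senv prev Q
  | .exS X φ, env, senv, prev, Q =>
      ∃ S : Set ℤ, S ⊆ D ∧ Fml.eval D I φ env (Function.update senv X S) prev Q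
  | .allS X φ, env, senv, prev, Q =>
      ∀ S : Set ℤ, S ⊆ D → Fml.eval D I φ env (Function.update senv X S) prev Q
  | .rpr n Θ tv ψ, env, senv, prev, Q =>
      -- the semantics of each Θ_j, as a function of the first-order environment
      -- and of the truth values of the `Q_j(t−1)` placeholders
      let f : Fin n → (ℕ → ℤ) → (ℕ → Prop) → Prop :=
        fun j env' prev' => Fml.eval D I (Θ j) env' senv prev' Q
      -- the recursively computed truth values of `Q_j` at time `k` (recursion on k from 0)
      let recQ : ℕ → Fin n → Prop := fun k =>
        Nat.rec (fun j => f j (Function.update env tv 0) (fun _ => False))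
          (fun m ih j => f j (Function.update env tv ((m : ℤ) + 1))
            (fun i => ∃ h : i < n, ih ⟨i, h⟩)) k
      Fml.eval D I ψ env senv prev
        (fun j z => ∃ h : j < n, 0 ≤ z ∧ recQ z.toNat ⟨j, h⟩)

/-- Free first-order variables of a formula. -/
def Fml.fvars : Fml → Set ℕ
  | .falsum => ∅
  | .atom _ x => {x}
  | .lt x y => {x, y}
  | .eq x y => {x, y}
  | .succ x y => {x, y}
  | .mod _ x => {x}
  | .svar _ x => {x}
  | .qprev _ => ∅
  | .qapp _ x => {x}
  | .neg φ => Fml.fvars φ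
  | .and φ ψ => Fml.fvars φ ∪ Fml.fvars ψ
  | .or φ ψ => Fml.fvars φ ∪ Fml.fvars ψ
  | .ex x φ => Fml.fvars φ \ {x}
  | .all x φ => Fml.fvars φ \ {x}
  | .exS _ φ => Fml.fvars φ
  | .allS _ φ => Fml.fvars φ
  | .rpr n Θ tv ψ => (⋃ j : Fin n, Fml.fvars (Θ j) \ {tv}) ∪ Fml.fvars ψ

/-- FO(<)-formulas: first-order logic with the built-in linear order
(and the definable equality predicate); no constants, no arithmetic. -/
def Fml.IsFOlt : Fml → Prop
  | .falsum => True
  | .atom _ _ => True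
  | .lt _ _ => True
  | .eq _ _ => True
  | .neg φ => Fml.IsFOlt φ
  | .and φ ψ => Fml.IsFOlt φ ∧ Fml.IsFOlt ψ
  | .or φ ψ => Fml.IsFOlt φ ∧ Fml.IsFOlt ψ
  | .ex _ φ => Fml.IsFOlt φ
  | .all _ φ => Fml.IsFOlt φ
  | _ => False

/-- FO(<,≡)-formulas: FO(<) extended with the predicates `t ≡ 0 (mod n)`, `n > 1`. -/
def Fml.IsFOltMod : Fml → Prop
  | .falsum => True
  | .atom _ _ => True
  | .lt _ _ => True
  | .eq _ _ => True
  | .mod n _ => 2 ≤ n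
  | .neg φ => Fml.IsFOltMod φ
  | .and φ ψ => Fml.IsFOltMod φ ∧ Fml.IsFOltMod ψ
  | .or φ ψ => Fml.IsFOltMod φ ∧ Fml.IsFOltMod ψ
  | .ex _ φ => Fml.IsFOltMod φ
  | .all _ φ => Fml.IsFOltMod φ
  | _ => False

/-- MSO(<)-formulas: FO(<) extended with set variables and second-order quantifiers. -/
def Fml.IsMSO : Fml → Prop
  | .falsum => True
  | .atom _ _ => True
  | .lt _ _ => True
  | .eq _ _ => True
  | .svar _ _ => True
  | .neg φ => Fml.IsMSO φ
  | .and φ ψ => Fml.IsMSO φ ∧ Fml.IsMSO ψ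
  | .or φ ψ => Fml.IsMSO φ ∧ Fml.IsMSO ψ
  | .ex _ φ => Fml.IsMSO φ
  | .all _ φ => Fml.IsMSO φ
  | .exS _ φ => Fml.IsMSO φ
  | .allS _ φ => Fml.IsMSO φ
  | _ => False

/-- FO(RPR)-formulas: FO(<) extended with successor and relational primitive recursion. -/
def Fml.IsRPR : Fml → Prop
  | .falsum => True
  | .atom _ _ => True
  | .lt _ _ => True
  | .eq _ _ => True
  | .succ _ _ => True
  | .qprev _ => True
  | .qapp _ _ => True
  | .neg φ => Fml.IsRPR φ
  | .and φ ψ => Fml.IsRPR φ ∧ Fml.IsRPR ψ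
  | .or φ ψ => Fml.IsRPR φ ∧ Fml.IsRPR ψ
  | .ex _ φ => Fml.IsRPR φ
  | .all _ φ => Fml.IsRPR φ
  | .rpr n Θ _ ψ => (∀ j : Fin n, Fml.IsRPR (Θ j)) ∧ Fml.IsRPR ψ
  | _ => False

/-- MFO(<)-formulas: monadic first-order formulas built from atoms `A(t)`,
`t < t'`, `t = t'` and `t = t' + 1`. -/
def Fml.IsMFO : Fml → Prop
  | .falsum => True
  | .atom _ _ => True
  | .lt _ _ => True
  | .eq _ _ => True
  | .succ _ _ => True
  | .neg φ => Fml.IsMFO φ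
  | .and φ ψ => Fml.IsMFO φ ∧ Fml.IsMFO ψ
  | .or φ ψ => Fml.IsMFO φ ∧ Fml.IsMFO ψ
  | .ex _ φ => Fml.IsMFO φ
  | .all _ φ => Fml.IsMFO φ
  | _ => False

/-- Quasi-positive MFO(<)-formulas: built from atoms `A(t)`, `t < t'`, `t = t'`,
`t = t' + 1` (and ⊥) using ∧, ∨, ∃, ∀ as well as guarded universal quantification
`∀y (x < y < z → φ)`, `∀y (x < y → φ)`, `∀y (y < z → φ)`
(the guarded implications are encoded via `¬guard ∨ φ`). -/
inductive Fml.IsQP : Fml → Prop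
  | falsum : Fml.IsQP .falsum
  | atom (a x : ℕ) : Fml.IsQP (.atom a x)
  | lt (x y : ℕ) : Fml.IsQP (.lt x y)
  | eq (x y : ℕ) : Fml.IsQP (.eq x y)
  | succ (x y : ℕ) : Fml.IsQP (.succ x y)
  | and {φ ψ : Fml} : Fml.IsQP φ → Fml.IsQP ψ → Fml.IsQP (.and φ ψ)
  | or {φ ψ : Fml} : Fml.IsQP φ → Fml.IsQP ψ → Fml.IsQP (.or φ ψ)
  | ex (x : ℕ) {φ : Fml} : Fml.IsQP φ → Fml.IsQP (.ex x φ)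
  | all (x : ℕ) {φ : Fml} : Fml.IsQP φ → Fml.IsQP (.all x φ)
  | allBtw (y x z : ℕ) {φ : Fml} : Fml.IsQP φ →
      Fml.IsQP (.all y (.or (.neg (.and (.lt x y) (.lt y z))) φ))
  | allGt (y x : ℕ) {φ : Fml} : Fml.IsQP φ →
      Fml.IsQP (.all y (.or (.neg (.lt x y)) φ))
  | allLt (y z : ℕ) {φ : Fml} : Fml.IsQP φ →
      Fml.IsQP (.all y (.or (.neg (.lt y z)) φ))

/-- Evaluation in a structure with domain `D` and unary predicates `I`
(no set variables, placeholders or relation variables supplied). -/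
def Fml.evalIn (D : Set ℤ) (I : Itp) (φ : Fml) (env : ℕ → ℤ) : Prop :=
  Fml.eval D I φ env (fun _ => ∅) (fun _ => False) (fun _ _ => False)

/-- An MFO(<)-formula is monotone if it is preserved under adding time points
to the extensions of the atomic concepts. -/
def MonotoneFml (ψ : Fml) : Prop :=
  ∀ M₁ M₂ : Itp, (∀ a : ℕ, M₁ a ⊆ M₂ a) → ∀ env : ℕ → ℤ,
    Fml.evalIn Set.univ M₁ ψ env → Fml.evalIn Set.univ M₂ ψ env

/-! ## The canonical model of a Horn ontology and a data instance -/

/-- Atoms of the closure: ⊥ or `C(n)` for a (basic) temporal concept `C` and `n ∈ ℤ`. -/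
inductive EAtom : Type where
  | bot : EAtom
  | conc : TC → ℤ → EAtom

/-- One (non-recursive) application of the closure rules of the canonical model. -/
def clStep (O : Ontology) (Λ : Set EAtom) : Set EAtom :=
  Λ ∪
  {e | ∃ cl ∈ O, ∃ n : ℤ, (∀ C ∈ cl.prem, EAtom.conc C n ∈ Λ) ∧
        ((∃ C : TC, cl.concl = [C] ∧ e = EAtom.conc C n) ∨
          (cl.concl = [] ∧ e = EAtom.bot))} ∪
  {e | ∃ C : TC, ∃ n k : ℤ, n < k ∧ EAtom.conc (.boxF C) n ∈ Λ ∧ e = EAtom.conc C k} ∪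
  {e | ∃ C : TC, ∃ n : ℤ, (∀ k : ℤ, n < k → EAtom.conc C k ∈ Λ) ∧
        e = EAtom.conc (.boxF C) n} ∪
  {e | ∃ C : TC, ∃ n : ℤ, EAtom.conc (.nextF C) n ∈ Λ ∧ e = EAtom.conc C (n + 1)} ∪
  {e | ∃ C : TC, ∃ n : ℤ, EAtom.conc C (n + 1) ∈ Λ ∧ e = EAtom.conc (.nextF C) n} ∪
  {e | ∃ C : TC, ∃ n k : ℤ, k < n ∧ EAtom.conc (.boxP C) n ∈ Λ ∧ e = EAtom.conc C k} ∪
  {e | ∃ C : TC, ∃ n : ℤ, (∀ k : ℤ, k < n → EAtom.conc C k ∈ Λ) ∧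
        e = EAtom.conc (.boxP C) n} ∪
  {e | ∃ C : TC, ∃ n : ℤ, EAtom.conc (.nextP C) n ∈ Λ ∧ e = EAtom.conc C (n - 1)} ∪
  {e | ∃ C : TC, ∃ n : ℤ, EAtom.conc C (n - 1) ∈ Λ ∧ e = EAtom.conc (.nextP C) n}

/-- Transfinite iteration of the closure rules. -/
noncomputable def clIter (O : Ontology) (Λ : Set EAtom) (o : Ordinal.{0}) : Set EAtom :=
  Ordinal.limitRecOn o Λ (fun _ ih => clStep O ih)
    (fun o _ ih => ⋃ (o' : Ordinal.{0}), ⋃ (h : o' < o), ih o' h)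

/-- The atoms of a data instance, as a set of closure atoms. -/
def dataAtoms (A : DataInstance) : Set EAtom :=
  {e | ∃ p ∈ A.atoms, e = EAtom.conc (.atom p.1) p.2}

open Ordinal in
/-- The canonical model `C_{O,A}`: the closure of `A` under the rules,
iterated up to the first uncountable ordinal ω₁. -/
noncomputable def canon (O : Ontology) (A : DataInstance) : Set EAtom :=
  clIter O (dataAtoms A) (Ordinal.omega 1)

/-- The canonical model regarded as a temporal interpretation. -/
noncomputable def canonItp (O : Ontology) (A : DataInstance) : Itp :=
  fun a => {n | EAtom.conc (.atom a) n ∈ canon O A}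

/-- The type `τ_{O,A}(n)`: the set of subconcepts of `O` that hold at `n`
in the canonical model. -/
noncomputable def tau (O : Ontology) (A : DataInstance) (n : ℤ) : Set TC :=
  {C ∈ O.subs | n ∈ TC.sem (canonItp O A) C}

/-! ## Literals and the reachability relation ⇝ for Krom ontologies -/

/-- A simple literal: an atomic concept with a polarity. -/
abbrev Lit : Type := ℕ × Bool

/-- The temporal concept corresponding to a literal. -/
def Lit.toTC (L : Lit) : TC := if L.2 then .atom L.1 else .neg (.atom L.1)

def TC.iterF : ℕ → TC → TC
  | 0, C => C
  | k + 1, C => .nextF (TC.iterF k C)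

def TC.iterP : ℕ → TC → TC
  | 0, C => C
  | k + 1, C => .nextP (TC.iterP k C)

/-- `○^k C`: `k` occurrences of ○F if `k > 0`, of ○P if `k < 0`. -/
def TC.shift (k : ℤ) (C : TC) : TC :=
  if 0 ≤ k then TC.iterF k.toNat C else TC.iterP (-k).toNat C

/-- `(L₁,n₁) ⇝ (L₂,n₂)`: in every model of `O`,
`(○^{n₁} L₁)^M ⊆ (○^{n₂} L₂)^M`. -/
def leadsTo (O : Ontology) (L₁ : Lit) (n₁ : ℤ) (L₂ : Lit) (n₂ : ℤ) : Prop :=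
  ∀ M : Itp, (∀ cl ∈ O, cl.holds M) →
    TC.sem M (TC.shift n₁ L₁.toTC) ⊆ TC.sem M (TC.shift n₂ L₂.toTC)


/-! ## The canonical model is the least model -/

theorem subset_clStep (O : Ontology) (Λ : Set EAtom) : Λ ⊆ clStep O Λ := by
  intro e he
  simp only [clStep, Set.mem_union]
  tauto

theorem clIter_zero (O : Ontology) (Λ : Set EAtom) : clIter O Λ 0 = Λ :=
  Ordinal.limitRecOn_zero ..

theorem clIter_add_one (O : Ontology) (Λ : Set EAtom) (o : Ordinal.{0}) :
    clIter O Λ (o + 1) = clStep O (clIter O Λ o) :=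
  Ordinal.limitRecOn_add_one ..

theorem clIter_limit (O : Ontology) (Λ : Set EAtom) {o : Ordinal.{0}} (ho : Order.IsSuccLimit o) :
    clIter O Λ o = ⋃ (o' : Ordinal.{0}), ⋃ (_ : o' < o), clIter O Λ o' :=
  Ordinal.limitRecOn_limit _ _ _ _ ho

theorem clIter_mono (O : Ontology) (Λ : Set EAtom) {o₁ o₂ : Ordinal.{0}} (h : o₁ ≤ o₂) :
    clIter O Λ o₁ ⊆ clIter O Λ o₂ := by
  induction o₂ using Ordinal.limitRecOn with
  | zero => rw [nonpos_iff_eq_zero.1 h]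
  | add_one o ih =>
    rcases h.lt_or_eq with h | rfl
    · rw [clIter_add_one]
      exact (ih (Order.lt_add_one_iff.1 h)).trans (subset_clStep _ _)
    · exact subset_rfl
  | limit o ho ih =>
    rcases h.lt_or_eq with h | rfl
    · rw [clIter_limit O Λ ho]
      exact Set.subset_iUnion₂_of_subset o₁ h subset_rfl
    · exact subset_rfl

theorem mem_canon_iff {O : Ontology} {A : DataInstance} {e : EAtom} :
    e ∈ canon O A ↔ ∃ o < Ordinal.omega 1, e ∈ clIter O (dataAtoms A) o := by
  rw [canon, clIter_limit _ _ (Cardinal.isSuccLimit_omega 1)]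
  simp

/-- Countably many elements of the canonical model all occur at a common stage. -/
theorem exists_stage {O : Ontology} {A : DataInstance} {ι : Type} [Countable ι] {e : ι → EAtom}
    (h : ∀ i, e i ∈ canon O A) :
    ∃ o < Ordinal.omega 1, ∀ i, e i ∈ clIter O (dataAtoms A) o := by
  choose f hf he using fun i => mem_canon_iff.1 (h i)
  exact ⟨⨆ i, f i, Ordinal.iSup_lt_omega_one hf,
    fun i => clIter_mono _ _ (Ordinal.le_iSup f i) (he i)⟩

theorem mem_canon_of_step {O : Ontology} {A : DataInstance} {ι : Type} [Countable ι]
    {e : ι → EAtom} (h : ∀ i, e i ∈ canon O A) {x : EAtom}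
    (hx : ∀ Λ : Set EAtom, (∀ i, e i ∈ Λ) → x ∈ clStep O Λ) : x ∈ canon O A := by
  obtain ⟨o, ho, h⟩ := exists_stage h
  refine mem_canon_iff.2 ⟨o + 1, (Cardinal.isSuccLimit_omega 1).add_one_lt ho, ?_⟩
  rw [clIter_add_one]
  exact hx _ h

theorem mem_canon_of_step_one {O : Ontology} {A : DataInstance} {e x : EAtom}
    (h : e ∈ canon O A) (hx : ∀ Λ : Set EAtom, e ∈ Λ → x ∈ clStep O Λ) : x ∈ canon O A :=
  mem_canon_of_step (ι := Unit) (e := fun _ => e) (fun _ => h) (fun Λ hΛ => hx Λ (hΛ ()))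

theorem mem_canonItp_sem_iff (O : Ontology) (A : DataInstance) {C : TC} (hC : C.IsBasic) (n : ℤ) :
    n ∈ TC.sem (canonItp O A) C ↔ EAtom.conc C n ∈ canon O A := by
  induction hC generalizing n with
  | atom a => rfl
  | @nextF C _ ih =>
    simp only [TC.sem, Set.mem_ofPred_eq, ih]
    refine ⟨fun h => mem_canon_of_step_one h fun Λ hΛ => ?_,
      fun h => mem_canon_of_step_one h fun Λ hΛ => ?_⟩
    · simp only [clStep, Set.mem_union, Set.mem_ofPred_eq]
      have : ∃ D : TC, ∃ m : ℤ, EAtom.conc D (m + 1) ∈ Λ ∧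
        EAtom.conc (.nextF C) n = EAtom.conc (.nextF D) m := ⟨C, n, hΛ, rfl⟩
      iterate 4 left
      right
      exact this
    · simp only [clStep, Set.mem_union, Set.mem_ofPred_eq]
      have : ∃ D : TC, ∃ m : ℤ, EAtom.conc (.nextF D) m ∈ Λ ∧
        EAtom.conc C (n + 1) = EAtom.conc D (m + 1) := ⟨C, n, hΛ, rfl⟩
      iterate 5 left
      right
      exact this
  | @nextP C _ ih =>
    simp only [TC.sem, Set.mem_ofPred_eq, ih]
    refine ⟨fun h => mem_canon_of_step_one h fun Λ hΛ => ?_,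
      fun h => mem_canon_of_step_one h fun Λ hΛ => ?_⟩
    · simp only [clStep, Set.mem_union, Set.mem_ofPred_eq]
      have : ∃ D : TC, ∃ m : ℤ, EAtom.conc D (m - 1) ∈ Λ ∧
        EAtom.conc (.nextP C) n = EAtom.conc (.nextP D) m := ⟨C, n, hΛ, rfl⟩
      right
      exact this
    · simp only [clStep, Set.mem_union, Set.mem_ofPred_eq]
      have : ∃ D : TC, ∃ m : ℤ, EAtom.conc (.nextP D) m ∈ Λ ∧
        EAtom.conc C (n - 1) = EAtom.conc D (m - 1) := ⟨C, n, hΛ, rfl⟩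
      iterate 1 left
      right
      exact this
  | @boxF C _ ih =>
    simp only [TC.sem, Set.mem_ofPred_eq, ih]
    refine ⟨fun h => mem_canon_of_step (ι := {k : ℤ // n < k}) (fun k => h k.1 k.2) fun Λ hΛ => ?_,
      fun h k hk => mem_canon_of_step_one h fun Λ hΛ => ?_⟩
    · simp only [clStep, Set.mem_union, Set.mem_ofPred_eq]
      have : ∃ D : TC, ∃ m : ℤ, (∀ k : ℤ, m < k → EAtom.conc D k ∈ Λ) ∧
        EAtom.conc (.boxF C) n = EAtom.conc (.boxF D) m :=
        ⟨C, n, fun k hk => hΛ ⟨k, hk⟩, rfl⟩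
      iterate 6 left
      right
      exact this
    · simp only [clStep, Set.mem_union, Set.mem_ofPred_eq]
      have : ∃ D : TC, ∃ m l : ℤ, m < l ∧ EAtom.conc (.boxF D) m ∈ Λ ∧
        EAtom.conc C k = EAtom.conc D l := ⟨C, n, k, hk, hΛ, rfl⟩
      iterate 7 left
      right
      exact this
  | @boxP C _ ih =>
    simp only [TC.sem, Set.mem_ofPred_eq, ih]
    refine ⟨fun h => mem_canon_of_step (ι := {k : ℤ // k < n}) (fun k => h k.1 k.2) fun Λ hΛ => ?_,
      fun h k hk => mem_canon_of_step_one h fun Λ hΛ => ?_⟩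
    · simp only [clStep, Set.mem_union, Set.mem_ofPred_eq]
      have : ∃ D : TC, ∃ m : ℤ, (∀ k : ℤ, k < m → EAtom.conc D k ∈ Λ) ∧
        EAtom.conc (.boxP C) n = EAtom.conc (.boxP D) m :=
        ⟨C, n, fun k hk => hΛ ⟨k, hk⟩, rfl⟩
      iterate 2 left
      right
      exact this
    · simp only [clStep, Set.mem_union, Set.mem_ofPred_eq]
      have : ∃ D : TC, ∃ m l : ℤ, l < m ∧ EAtom.conc (.boxP D) m ∈ Λ ∧
        EAtom.conc C k = EAtom.conc D l := ⟨C, n, k, hk, hΛ, rfl⟩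
      iterate 3 left
      right
      exact this

/-- The closure atoms that are true in an interpretation. -/
def trueAtoms (M : Itp) : Set EAtom :=
  {e | ∃ (C : TC) (n : ℤ), e = EAtom.conc C n ∧ n ∈ TC.sem M C}

theorem conc_mem_trueAtoms {M : Itp} {C : TC} {n : ℤ} :
    EAtom.conc C n ∈ trueAtoms M ↔ n ∈ TC.sem M C := by
  simp [trueAtoms]

theorem clStep_subset_trueAtoms {O : Ontology} {M : Itp} (hM : ∀ cl ∈ O, cl.holds M)
    {Λ : Set EAtom} (hΛ : Λ ⊆ trueAtoms M) : clStep O Λ ⊆ trueAtoms M := by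
  have key : ∀ {C : TC} {n : ℤ}, EAtom.conc C n ∈ Λ → n ∈ TC.sem M C :=
    fun h => conc_mem_trueAtoms.1 (hΛ h)
  intro e he
  simp only [clStep, Set.mem_union, Set.mem_ofPred_eq] at he
  rcases he with ((((((((he | ⟨cl, hcl, n, hp, hc⟩) | ⟨C, n, k, hk, h, rfl⟩) | ⟨C, n, h, rfl⟩) |
    ⟨C, n, h, rfl⟩) | ⟨C, n, h, rfl⟩) | ⟨C, n, k, hk, h, rfl⟩) | ⟨C, n, h, rfl⟩) |
    ⟨C, n, h, rfl⟩) | ⟨C, n, h, rfl⟩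
  · exact hΛ he
  · obtain ⟨D, hD, hn⟩ := hM cl hcl n fun C hC => key (hp C hC)
    rcases hc with ⟨C, hC, rfl⟩ | ⟨hC, rfl⟩
    · rw [hC, List.mem_singleton] at hD
      subst hD
      exact conc_mem_trueAtoms.2 hn
    · simp [hC] at hD
  all_goals rw [conc_mem_trueAtoms]
  · exact key h k hk
  · exact fun k hk => key (h k hk)
  · exact (key h :)
  · exact (key h :)
  · exact key h k hk
  · exact fun k hk => key (h k hk)
  · exact (key h :)
  · exact (key h :)

theorem canon_subset_trueAtoms {O : Ontology} {A : DataInstance} {M : Itp} (hM : IsModel M O A) :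
    canon O A ⊆ trueAtoms M := by
  rw [canon]
  induction Ordinal.omega 1 using Ordinal.limitRecOn with
  | zero =>
    rw [clIter_zero]
    rintro e ⟨p, hp, rfl⟩
    exact conc_mem_trueAtoms.2 (hM.2 p hp)
  | add_one o ih =>
    rw [clIter_add_one]
    exact clStep_subset_trueAtoms hM.1 ih
  | limit o ho ih =>
    rw [clIter_limit _ _ ho]
    exact Set.iUnion₂_subset ih

theorem canonItp_subset {O : Ontology} {A : DataInstance} {M : Itp} (hM : IsModel M O A) (a : ℕ) :
    canonItp O A a ⊆ M a := fun _ hn =>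
  conc_mem_trueAtoms.1 (canon_subset_trueAtoms hM hn)

theorem canonItp_isModel {O : Ontology} (hO : O.HornBoxNext) {A : DataInstance}
    (hA : ConsistentWith O A) : IsModel (canonItp O A) O A := by
  refine ⟨fun cl hcl n hp => ?_, fun p hp => mem_canon_iff.2 ⟨0, ?_, ?_⟩⟩
  · obtain ⟨⟨hbp, hbc⟩, hh⟩ := hO cl hcl
    have step : ∀ x : EAtom, ((∃ C : TC, cl.concl = [C] ∧ x = EAtom.conc C n) ∨
        (cl.concl = [] ∧ x = EAtom.bot)) → x ∈ canon O A := by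
      intro x hx
      refine mem_canon_of_step (ι := Fin cl.prem.length) (e := fun i => EAtom.conc (cl.prem.get i) n)
        (fun i => (mem_canonItp_sem_iff O A (hbp _ (List.get_mem ..)) n).1
          (hp _ (List.get_mem ..))) fun Λ hΛ => ?_
      have : ∃ cl ∈ O, ∃ n : ℤ, (∀ C ∈ cl.prem, EAtom.conc C n ∈ Λ) ∧
          ((∃ C : TC, cl.concl = [C] ∧ x = EAtom.conc C n) ∨
            (cl.concl = [] ∧ x = EAtom.bot)) := by
        refine ⟨cl, hcl, n, fun C hC => ?_, hx⟩
        obtain ⟨i, rfl⟩ := List.get_of_mem hC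
        exact hΛ i
      simp only [clStep, Set.mem_union, Set.mem_ofPred_eq]
      iterate 8 left
      right
      exact this
    unfold Clause.Horn at hh
    rcases hc : cl.concl with _ | ⟨C, _ | ⟨D, l⟩⟩
    · obtain ⟨M, hM⟩ := hA
      obtain ⟨C, n, h, -⟩ := canon_subset_trueAtoms hM (step _ (Or.inr ⟨hc, rfl⟩))
      cases h
    · exact ⟨C, by simp, (mem_canonItp_sem_iff O A (hbc C (by simp [hc])) n).2
        (step _ (Or.inl ⟨C, hc, rfl⟩))⟩
    · simp [hc] at hh
  · exact Ordinal.omega_pos 1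
  · rw [clIter_zero]
    exact ⟨p, hp, rfl⟩

/-! ## Subconcepts -/

theorem TC.mem_subs_self (C : TC) : C ∈ C.subs := by
  cases C <;> simp [TC.subs]

theorem TC.IsBasic.of_mem_subs {C D : TC} (hD : D.IsBasic) (h : C ∈ D.subs) : C.IsBasic := by
  induction hD with
  | atom a =>
    rw [TC.subs, Set.mem_singleton_iff] at h
    exact h ▸ .atom a
  | nextF hD ih =>
    rcases h with rfl | h
    exacts [hD.nextF, ih h]
  | nextP hD ih =>
    rcases h with rfl | h
    exacts [hD.nextP, ih h]
  | boxF hD ih =>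
    rcases h with rfl | h
    exacts [hD.boxF, ih h]
  | boxP hD ih =>
    rcases h with rfl | h
    exacts [hD.boxP, ih h]

theorem TC.subs_subset {C D : TC} (h : C ∈ D.subs) : C.subs ⊆ D.subs := by
  induction D with
  | top =>
    rw [TC.subs, Set.mem_singleton_iff] at h
    rw [h]
  | atom a =>
    rw [TC.subs, Set.mem_singleton_iff] at h
    rw [h]
  | neg D ih | nextF D ih | diamF D ih | boxF D ih | nextP D ih | diamP D ih | boxP D ih =>
    rcases h with rfl | h
    · exact subset_rfl
    · exact (ih h).trans (Set.subset_insert _ _)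
  | and D E ihD ihE | or D E ihD ihE | untl D E ihD ihE | since D E ihD ihE =>
    rcases h with rfl | h | h
    · exact subset_rfl
    · exact ((ihD h).trans Set.subset_union_left).trans (Set.subset_insert _ _)
    · exact ((ihE h).trans Set.subset_union_right).trans (Set.subset_insert _ _)

theorem Ontology.subs_subset {O : Ontology} {C : TC} (h : C ∈ O.subs) : C.subs ⊆ O.subs := by
  obtain ⟨cl, hcl, D, hD, hC⟩ := h
  exact fun E hE => ⟨cl, hcl, D, hD, TC.subs_subset hC hE⟩

theorem Ontology.HornBoxNext.isBasic_of_mem_subs {O : Ontology} (hO : O.HornBoxNext) {C : TC}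
    (h : C ∈ O.subs) : C.IsBasic := by
  obtain ⟨cl, hcl, D, hD, hC⟩ := h
  exact (hD.elim ((hO cl hcl).1.1 D) ((hO cl hcl).1.2 D)).of_mem_subs hC

open Classical in
theorem exists_finset_insert_subset {α : Type*} (x : α) {T : Set α} {k : ℕ}
    (h : ∃ S : Finset α, T ⊆ S ∧ S.card ≤ k) :
    ∃ S : Finset α, insert x T ⊆ S ∧ S.card ≤ k + 1 := by
  obtain ⟨S, hS, hc⟩ := h
  refine ⟨insert x S, ?_, (Finset.card_insert_le _ _).trans (Nat.succ_le_succ hc)⟩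
  rw [Finset.coe_insert]
  exact Set.insert_subset_insert hS

open Classical in
theorem exists_finset_union_subset {α : Type*} {T U : Set α} {k l : ℕ}
    (hT : ∃ S : Finset α, T ⊆ S ∧ S.card ≤ k) (hU : ∃ S : Finset α, U ⊆ S ∧ S.card ≤ l) :
    ∃ S : Finset α, T ∪ U ⊆ S ∧ S.card ≤ k + l := by
  obtain ⟨S, hS, hSc⟩ := hT
  obtain ⟨R, hR, hRc⟩ := hU
  refine ⟨S ∪ R, ?_, (Finset.card_union_le _ _).trans (Nat.add_le_add hSc hRc)⟩
  rw [Finset.coe_union]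
  exact Set.union_subset_union hS hR

theorem TC.exists_finset_subs (C : TC) : ∃ S : Finset TC, C.subs ⊆ S ∧ S.card ≤ C.size := by
  induction C with
  | top => exact ⟨{.top}, by simp [TC.subs], by simp [TC.size]⟩
  | atom a => exact ⟨{.atom a}, by simp [TC.subs], by simp [TC.size]⟩
  | neg D ih | nextF D ih | diamF D ih | boxF D ih | nextP D ih | diamP D ih | boxP D ih =>
    exact exists_finset_insert_subset _ ih
  | and D E ihD ihE | or D E ihD ihE | untl D E ihD ihE | since D E ihD ihE =>
    exact exists_finset_insert_subset _ (exists_finset_union_subset ihD ihE)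

theorem exists_finset_cover {α β : Type*} {f : α → Set β} {w : α → ℕ}
    (h : ∀ x, ∃ S : Finset β, f x ⊆ S ∧ S.card ≤ w x) (l : List α) :
    ∃ S : Finset β, (∀ x ∈ l, f x ⊆ S) ∧ S.card ≤ (l.map w).sum := by
  induction l with
  | nil => exact ⟨∅, by simp, by simp⟩
  | cons x l ih =>
    obtain ⟨T, hT, hTc⟩ := ih
    obtain ⟨S, hS, hSc⟩ := exists_finset_union_subset (h x) ⟨T, subset_rfl, hTc⟩
    rw [Set.union_subset_iff] at hS
    refine ⟨S, fun y hy => ?_, hSc⟩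
    rcases List.mem_cons.1 hy with rfl | hy
    exacts [hS.1, (hT y hy).trans hS.2]

theorem Clause.exists_finset_subs (cl : Clause) :
    ∃ S : Finset TC, {C | ∃ D : TC, (D ∈ cl.prem ∨ D ∈ cl.concl) ∧ C ∈ D.subs} ⊆ S ∧
      S.card ≤ cl.size := by
  obtain ⟨S, hS, hSc⟩ := exists_finset_cover TC.exists_finset_subs cl.prem
  obtain ⟨T, hT, hTc⟩ := exists_finset_cover TC.exists_finset_subs cl.concl
  obtain ⟨R, hR, hRc⟩ :=
    exists_finset_union_subset ⟨S, subset_rfl, hSc⟩ ⟨T, subset_rfl, hTc⟩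
  refine ⟨R, ?_, hRc.trans (Nat.le_succ _)⟩
  rintro C ⟨D, hD | hD, hC⟩
  exacts [hR (Or.inl (hS D hD hC)), hR (Or.inr (hT D hD hC))]

theorem Ontology.exists_finset_subs (O : Ontology) :
    ∃ S : Finset TC, O.subs ⊆ S ∧ S.card ≤ O.size := by
  obtain ⟨S, hS, hSc⟩ := exists_finset_cover Clause.exists_finset_subs O
  refine ⟨S, ?_, hSc⟩
  rintro C ⟨cl, hcl, hC⟩
  exact hS cl hcl hC

/-- Among `2 ^ |O| + 1` consecutive time points, two have the same type. -/
theorem exists_tau_eq (O : Ontology) (A : DataInstance) (m : ℤ) :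
    ∃ i j : ℤ, m ≤ i ∧ i < j ∧ j ≤ m + 2 ^ O.size ∧ tau O A i = tau O A j := by
  classical
  obtain ⟨S, hS, hSc⟩ := O.exists_finset_subs
  have hsub : ∀ n, tau O A n ⊆ S := fun n C hC => hS hC.1
  obtain ⟨i, hi, j, hj, hij, h⟩ := Finset.exists_ne_map_eq_of_card_lt_of_maps_to
    (s := Finset.Icc m (m + 2 ^ O.size)) (t := S.powerset)
    (f := fun n => S.filter (· ∈ tau O A n)) (by
      rw [Finset.card_powerset, Int.card_Icc]
      have h1 : 2 ^ S.card ≤ 2 ^ O.size := Nat.pow_le_pow_right two_pos hSc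
      have h2 : (((2 ^ O.size : ℕ) : ℤ)) = 2 ^ O.size := by push_cast; rfl
      omega) (by
      exact fun n _ => Finset.mem_coe.2 (Finset.mem_powerset.2 (Finset.filter_subset _ _)))
  have heq : tau O A i = tau O A j := by
    ext C
    have := Finset.ext_iff.1 h C
    simp only [Finset.mem_filter] at this
    exact ⟨fun hC => (this.1 ⟨hsub i hC, hC⟩).2, fun hC => (this.2 ⟨hsub j hC, hC⟩).2⟩
  rw [Finset.mem_Icc] at hi hj
  rcases lt_or_gt_of_ne hij with hij | hij
  · exact ⟨i, j, hi.1, hij, hj.2, heq⟩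
  · exact ⟨j, i, hj.1, hij, hi.2, heq.symm⟩

/-! ## Gluing shifted halves of an interpretation -/

theorem TC.IsBasic.sem_mono {M N : Itp} (h : ∀ a, M a ⊆ N a) {C : TC} (hC : C.IsBasic) :
    TC.sem M C ⊆ TC.sem N C := by
  induction hC with
  | atom a => exact h a
  | nextF _ ih => exact fun n hn => ih hn
  | nextP _ ih => exact fun n hn => ih hn
  | boxF _ ih => exact fun n hn k hk => ih (hn k hk)
  | boxP _ ih => exact fun n hn k hk => ih (hn k hk)

/-- The interpretation that looks like `M` shifted by `a` up to time `c`, and like `M` shifted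
by `b` after time `c`. -/
def glue (M : Itp) (c a b : ℤ) : Itp := fun x => {n | (if n ≤ c then n + a else n + b) ∈ M x}

theorem mem_sem_glue {M : Itp} {c a b : ℤ} {D : TC} (hD : D.IsBasic)
    (hab : ∀ C ∈ D.subs, c + a ∈ TC.sem M C ↔ c + b ∈ TC.sem M C) (n : ℤ) :
    (n ≤ c → (n ∈ TC.sem (glue M c a b) D ↔ n + a ∈ TC.sem M D)) ∧
      (c ≤ n → (n ∈ TC.sem (glue M c a b) D ↔ n + b ∈ TC.sem M D)) := by
  have hself := hab D D.mem_subs_self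
  induction hD generalizing n with
  | atom x =>
    simp only [TC.sem, glue, Set.mem_ofPred_eq] at hself ⊢
    refine ⟨fun h => by rw [if_pos h], fun h => ?_⟩
    rcases h.eq_or_lt with rfl | h
    · rw [if_pos le_rfl, hself]
    · rw [if_neg h.not_ge]
  | @nextF C _ ih =>
    have hC : ∀ E ∈ C.subs, c + a ∈ TC.sem M E ↔ c + b ∈ TC.sem M E := fun E hE =>
      hab E (Set.mem_insert_of_mem _ hE)
    replace ih := fun m => ih hC m (hC C C.mem_subs_self)
    simp only [TC.sem, Set.mem_ofPred_eq] at hself ⊢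
    have right : c ≤ n → (n + 1 ∈ TC.sem (glue M c a b) C ↔ n + b + 1 ∈ TC.sem M C) := fun h => by
      rw [(ih (n + 1)).2 (by omega), add_right_comm]
    refine ⟨fun h => ?_, right⟩
    rcases h.eq_or_lt with rfl | h
    · rw [right le_rfl, hself]
    · rw [(ih (n + 1)).1 (by omega), add_right_comm]
  | @nextP C _ ih =>
    have hC : ∀ E ∈ C.subs, c + a ∈ TC.sem M E ↔ c + b ∈ TC.sem M E := fun E hE =>
      hab E (Set.mem_insert_of_mem _ hE)
    replace ih := fun m => ih hC m (hC C C.mem_subs_self)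
    simp only [TC.sem, Set.mem_ofPred_eq] at hself ⊢
    have left : n ≤ c → (n - 1 ∈ TC.sem (glue M c a b) C ↔ n + a - 1 ∈ TC.sem M C) := fun h => by
      rw [(ih (n - 1)).1 (by omega), sub_add_eq_add_sub]
    refine ⟨left, fun h => ?_⟩
    rcases h.eq_or_lt with rfl | h
    · rw [left le_rfl, hself]
    · rw [(ih (n - 1)).2 (by omega), sub_add_eq_add_sub]
  | @boxF C _ ih =>
    have hC : ∀ E ∈ C.subs, c + a ∈ TC.sem M E ↔ c + b ∈ TC.sem M E := fun E hE =>
      hab E (Set.mem_insert_of_mem _ hE)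
    replace ih := fun m => ih hC m (hC C C.mem_subs_self)
    simp only [TC.sem, Set.mem_ofPred_eq] at hself ⊢
    refine ⟨fun h => ⟨fun H k hk => ?_, fun H k hk => ?_⟩,
      fun h => ⟨fun H k hk => ?_, fun H k hk => ?_⟩⟩
    · rcases le_or_gt k (c + a) with hkc | hkc
      · have := ((ih (k - a)).1 (by omega)).1 (H _ (by omega))
        rwa [sub_add_cancel] at this
      · refine hself.2 (fun l hl => ?_) k hkc
        have := ((ih (l - b)).2 (by omega)).1 (H _ (by omega))
        rwa [sub_add_cancel] at this
    · rcases le_or_gt k c with hkc | hkc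
      · exact ((ih k).1 hkc).2 (H _ (by omega))
      · exact ((ih k).2 hkc.le).2 (hself.1 (fun l hl => H l (by omega)) _ (by omega))
    · have := ((ih (k - b)).2 (by omega)).1 (H _ (by omega))
      rwa [sub_add_cancel] at this
    · exact ((ih k).2 (by omega)).2 (H _ (by omega))
  | @boxP C _ ih =>
    have hC : ∀ E ∈ C.subs, c + a ∈ TC.sem M E ↔ c + b ∈ TC.sem M E := fun E hE =>
      hab E (Set.mem_insert_of_mem _ hE)
    replace ih := fun m => ih hC m (hC C C.mem_subs_self)
    simp only [TC.sem, Set.mem_ofPred_eq] at hself ⊢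
    refine ⟨fun h => ⟨fun H k hk => ?_, fun H k hk => ?_⟩,
      fun h => ⟨fun H k hk => ?_, fun H k hk => ?_⟩⟩
    · have := ((ih (k - a)).1 (by omega)).1 (H _ (by omega))
      rwa [sub_add_cancel] at this
    · exact ((ih k).1 (by omega)).2 (H _ (by omega))
    · rcases le_or_gt (c + b) k with hkc | hkc
      · have := ((ih (k - b)).2 (by omega)).1 (H _ (by omega))
        rwa [sub_add_cancel] at this
      · refine hself.1 (fun l hl => ?_) k hkc
        have := ((ih (l - a)).1 (by omega)).1 (H _ (by omega))
        rwa [sub_add_cancel] at this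
    · rcases le_or_gt c k with hkc | hkc
      · exact ((ih k).2 hkc).2 (H _ (by omega))
      · exact ((ih k).1 hkc.le).2 (hself.2 (fun l hl => H l (by omega)) _ (by omega))

theorem tau_subset_of_glue {O : Ontology} (hO : O.HornBoxNext) {A : DataInstance}
    (hA : ConsistentWith O A) {c a b : ℤ} (hab : tau O A (c + a) = tau O A (c + b))
    (hdata : ∀ p ∈ A.atoms, (p.2 ≤ c ∧ a = 0) ∨ (c < p.2 ∧ b = 0)) (n : ℤ) :
    (n ≤ c → tau O A n ⊆ tau O A (n + a)) ∧ (c ≤ n → tau O A n ⊆ tau O A (n + b)) := by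
  have hM := canonItp_isModel hO hA
  have hglue : ∀ D ∈ O.subs, ∀ n : ℤ,
      (n ≤ c → (n ∈ TC.sem (glue (canonItp O A) c a b) D ↔ n + a ∈ TC.sem (canonItp O A) D)) ∧
      (c ≤ n → (n ∈ TC.sem (glue (canonItp O A) c a b) D ↔ n + b ∈ TC.sem (canonItp O A) D)) := by
    intro D hD
    refine mem_sem_glue (hO.isBasic_of_mem_subs hD) fun C hC => ?_
    have hCO := Ontology.subs_subset hD hC
    have := Set.ext_iff.1 hab C
    simp only [tau, Set.mem_ofPred_eq, hCO, true_and] at this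
    exact this
  have hmodel : IsModel (glue (canonItp O A) c a b) O A := by
    refine ⟨fun cl hcl m hp => ?_, fun p hp => ?_⟩
    · have hpm : ∀ C ∈ cl.prem, C ∈ O.subs := fun C hC =>
        ⟨cl, hcl, C, Or.inl hC, C.mem_subs_self⟩
      have hcm : ∀ C ∈ cl.concl, C ∈ O.subs := fun C hC =>
        ⟨cl, hcl, C, Or.inr hC, C.mem_subs_self⟩
      rcases le_total m c with hm | hm
      · obtain ⟨D, hD, h⟩ := hM.1 cl hcl (m + a) fun C hC =>
          ((hglue C (hpm C hC) m).1 hm).1 (hp C hC)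
        exact ⟨D, hD, ((hglue D (hcm D hD) m).1 hm).2 h⟩
      · obtain ⟨D, hD, h⟩ := hM.1 cl hcl (m + b) fun C hC =>
          ((hglue C (hpm C hC) m).2 hm).1 (hp C hC)
        exact ⟨D, hD, ((hglue D (hcm D hD) m).2 hm).2 h⟩
    · have := hM.2 p hp
      rcases hdata p hp with ⟨h, rfl⟩ | ⟨h, rfl⟩
      · simpa [glue, h] using this
      · simpa [glue, h.not_ge] using this
  have hsub : ∀ D ∈ O.subs, TC.sem (canonItp O A) D ⊆ TC.sem (glue (canonItp O A) c a b) D :=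
    fun D hD => (hO.isBasic_of_mem_subs hD).sem_mono (canonItp_subset hmodel)
  exact ⟨fun hn D hD => ⟨hD.1, ((hglue D hD.1 n).1 hn).1 (hsub D hD.1 hD.2)⟩,
    fun hn D hD => ⟨hD.1, ((hglue D hD.1 n).2 hn).1 (hsub D hD.1 hD.2)⟩⟩

/-- A repetition of types after the data makes the canonical model periodic to the right. -/
theorem tau_add_eq {O : Ontology} (hO : O.HornBoxNext) {A : DataInstance}
    (hA : ConsistentWith O A) {i j : ℤ} (hi : A.maxT ≤ i) (hij : i < j)
    (h : tau O A i = tau O A j) {n : ℤ} (hn : i ≤ n) : tau O A n = tau O A (n + (j - i)) := by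
  have hd : ∀ p ∈ A.atoms, p.2 ≤ A.maxT := fun p hp =>
    Finset.le_max' _ _ (Finset.mem_image_of_mem _ hp)
  apply Set.Subset.antisymm
  · exact (tau_subset_of_glue hO hA (c := i) (a := 0) (b := j - i) (by simpa using h)
      (fun p hp => Or.inl ⟨(hd p hp).trans hi, rfl⟩) n).2 hn
  · have := (tau_subset_of_glue hO hA (c := j) (a := 0) (b := i - j) (by simpa using h.symm)
      (fun p hp => Or.inl ⟨(hd p hp).trans (hi.trans hij.le), rfl⟩) (n + (j - i))).2 (by omega)
    rwa [show n + (j - i) + (i - j) = n by ring] at this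

/-- A repetition of types before the data makes the canonical model periodic to the left. -/
theorem tau_sub_eq {O : Ontology} (hO : O.HornBoxNext) {A : DataInstance}
    (hA : ConsistentWith O A) {i j : ℤ} (hj : j < A.minT) (hij : i < j)
    (h : tau O A i = tau O A j) {n : ℤ} (hn : n ≤ j) : tau O A n = tau O A (n - (j - i)) := by
  have hd : ∀ p ∈ A.atoms, A.minT ≤ p.2 := fun p hp =>
    Finset.min'_le _ _ (Finset.mem_image_of_mem _ hp)
  apply Set.Subset.antisymm
  · have := (tau_subset_of_glue hO hA (c := j) (a := i - j) (b := 0) (by simpa using h)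
      (fun p hp => Or.inr ⟨hj.trans_le (hd p hp), rfl⟩) n).1 hn
    rwa [show n + (i - j) = n - (j - i) by ring] at this
  · have := (tau_subset_of_glue hO hA (c := i) (a := j - i) (b := 0) (by simpa using h.symm)
      (fun p hp => Or.inr ⟨(hij.trans hj).trans_le (hd p hp), rfl⟩) (n - (j - i))).1 (by omega)
    rwa [sub_add_cancel] at this

/-- periodicity of the canonical model of an LTL_horn^□○
ontology and a data instance. -/
theorem canonical_model_periodic (O : Ontology) (hO : O.HornBoxNext)
    (A : DataInstance) (hA : ConsistentWith O A) :
    ∃ s p : ℕ, 0 < s ∧ 0 < p ∧ s ≤ 2 ^ O.size ∧ p ≤ 2 ^ (2 * O.size) ∧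
      (∀ n : ℤ, n ≤ A.minT - (s : ℤ) → tau O A n = tau O A (n - (p : ℤ))) ∧
      (∀ n : ℤ, A.maxT + (s : ℤ) ≤ n → tau O A n = tau O A (n + (p : ℤ))) := by
  obtain ⟨i, j, hi, hij, hj, h⟩ := exists_tau_eq O A A.maxT
  obtain ⟨i', j', hi', hij', hj', h'⟩ := exists_tau_eq O A (A.minT - 1 - 2 ^ O.size)
  obtain ⟨p, hp⟩ := Int.eq_ofNat_of_zero_le (sub_nonneg.2 hij.le)
  obtain ⟨q, hq⟩ := Int.eq_ofNat_of_zero_le (sub_nonneg.2 hij'.le)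
  have hpow : ((2 ^ O.size : ℕ) : ℤ) = 2 ^ O.size := by push_cast; rfl
  have right : ∀ (k : ℕ) (n : ℤ), i ≤ n → tau O A n = tau O A (n + (k * p : ℕ)) := by
    intro k
    induction k with
    | zero => simp
    | succ k ih =>
      intro n hn
      rw [ih n hn, tau_add_eq hO hA hi hij h (n := n + (k * p : ℕ)) (by omega), hp]
      congr 1
      push_cast
      ring
  have left : ∀ (k : ℕ) (n : ℤ), n ≤ j' → tau O A n = tau O A (n - (k * q : ℕ)) := by
    intro k
    induction k with
    | zero => simp
    | succ k ih =>
      intro n hn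
      rw [ih n hn, tau_sub_eq hO hA (by omega) hij' h' (n := n - (k * q : ℕ)) (by omega), hq]
      congr 1
      push_cast
      ring
  refine ⟨2 ^ O.size, p * q, by positivity, Nat.mul_pos (by omega) (by omega), le_rfl, ?_,
    fun n hn => left p n (by omega), fun n hn => ?_⟩
  · rw [two_mul, pow_add]
    exact Nat.mul_le_mul (by omega) (by omega)
  · rw [mul_comm]
    exact right q n (by omega)

end LTLOMQ
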